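/- Let n ≥ 1 and let a > 0 be a real constant. There is no smooth positive function u : ℝⁿ → ℝ satisfying Δu + a·u·(π/2 − arctan(ln u)) = 0 on all of ℝⁿ. -/

import Mathlib

open Real Metric

/-- The Euclidean Laplacian: trace of the Hessian. -/
noncomputable def lap {n : ℕ} (f : EuclideanSpace ℝ (Fin n) → ℝ)
    (x : EuclideanSpace ℝ (Fin n)) : ℝ :=
  ∑ i : Fin n,
    fderiv ℝ (fun y => fderiv ℝ f y (EuclideanSpace.single i 1)) x
      (EuclideanSpace.single i 1)

/-- Second-order necessary condition at a local minimum of a function of one real variable. -/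
theorem IsLocalMin.second_deriv_nonneg {g g' : ℝ → ℝ} {c s : ℝ}
    (hg : ∀ s, HasDerivAt g (g' s) s) (hg' : HasDerivAt g' c s) (hmin : IsLocalMin g s) :
    0 ≤ c := by
  by_contra! hc
  have hd : deriv g = g' := funext fun s => (hg s).deriv
  have hmax : IsLocalMax g s := by
    apply isLocalMax_of_deriv_deriv_neg
    · rwa [hd, hg'.deriv]
    · exact hmin.deriv_eq_zero
    · exact (hg s).continuousAt
  have hconst : g =ᶠ[nhds s] fun _ => g s := by
    filter_upwards [hmin, hmax] with y h₁ h₂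
    exact le_antisymm h₂ h₁
  have h2 := hconst.deriv.deriv_eq
  rw [hd, hg'.deriv] at h2
  simp at h2
  exact hc.ne h2

/-- Squared norm along a line in a coordinate direction. -/
theorem EuclideanSpace.norm_add_smul_single_sq {n : ℕ} (x : EuclideanSpace ℝ (Fin n))
    (i : Fin n) (s : ℝ) :
    ‖x + s • EuclideanSpace.single i (1 : ℝ)‖ ^ 2 = ‖x‖ ^ 2 + 2 * s * x i + s ^ 2 := by
  rw [norm_add_sq_real, inner_smul_right, norm_smul]
  simp [EuclideanSpace.inner_single_right]
  ring

/-- If `M u - (ρ - ‖·‖²)²` has a local minimum at `x`, then its Laplacian there is nonnegative. -/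
theorem lap_ge_of_isLocalMin {n : ℕ} {u : EuclideanSpace ℝ (Fin n) → ℝ} {M ρ : ℝ}
    {x : EuclideanSpace ℝ (Fin n)} (hu : ContDiff ℝ 2 u)
    (hmin : IsLocalMin (fun y => M * u y - (ρ - ‖y‖ ^ 2) ^ 2) x) :
    8 * ‖x‖ ^ 2 - 4 * n * (ρ - ‖x‖ ^ 2) ≤ M * lap u x := by
  have key : ∀ i : Fin n, 8 * x i ^ 2 - 4 * (ρ - ‖x‖ ^ 2) ≤
      M * fderiv ℝ (fun y => fderiv ℝ u y (EuclideanSpace.single i 1)) x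
        (EuclideanSpace.single i 1) := by
    intro i
    set e : EuclideanSpace ℝ (Fin n) := EuclideanSpace.single i 1 with he
    have hl : ∀ s : ℝ, HasDerivAt (fun s : ℝ => x + s • e) e s := fun s => by
      simpa using ((hasDerivAt_id s).smul_const e).const_add x
    have hdu : Differentiable ℝ u := hu.differentiable (by norm_num)
    have hdu' : Differentiable ℝ (fun y => fderiv ℝ u y e) :=
      ((hu.fderiv_right (m := 1) (by norm_num)).clm_apply contDiff_const).differentiable
        (by norm_num)
    have h1 : ∀ s : ℝ, HasDerivAt (fun s : ℝ => u (x + s • e)) (fderiv ℝ u (x + s • e) e) s :=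
      fun s => (hdu _).hasFDerivAt.comp_hasDerivAt s (hl s)
    have h2 : HasDerivAt (fun s : ℝ => fderiv ℝ u (x + s • e) e)
        (fderiv ℝ (fun y => fderiv ℝ u y e) x e) 0 := by
      have := (hdu' (x + (0 : ℝ) • e)).hasFDerivAt.comp_hasDerivAt (0 : ℝ) (hl 0)
      simpa [Function.comp_def] using this
    have hq : ∀ s : ℝ, HasDerivAt (fun s : ℝ => ρ - (‖x‖ ^ 2 + 2 * s * x i + s ^ 2))
        (-(2 * x i + 2 * s)) s := fun s => by
      have := (((((hasDerivAt_id s).const_mul 2).mul_const (x i)).const_add (‖x‖ ^ 2)).add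
        ((hasDerivAt_id s).pow 2)).const_sub ρ
      exact this.congr_deriv (by simp)
    have h3 : ∀ s : ℝ, HasDerivAt (fun s : ℝ => (ρ - (‖x‖ ^ 2 + 2 * s * x i + s ^ 2)) ^ 2)
        (2 * (ρ - (‖x‖ ^ 2 + 2 * s * x i + s ^ 2)) * (-(2 * x i + 2 * s))) s := fun s => by
      exact ((hq s).pow 2).congr_deriv (by simp)
    have h4 : HasDerivAt
        (fun s : ℝ => 2 * (ρ - (‖x‖ ^ 2 + 2 * s * x i + s ^ 2)) * (-(2 * x i + 2 * s)))
        (8 * x i ^ 2 - 4 * (ρ - ‖x‖ ^ 2)) 0 := by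
      have := ((hq 0).const_mul 2).mul
        (((hasDerivAt_id (0 : ℝ)).const_mul 2).const_add (2 * x i)).neg
      exact this.congr_deriv (by simp; ring)
    have hmin' : IsLocalMin
        (fun s : ℝ => M * u (x + s • e) - (ρ - (‖x‖ ^ 2 + 2 * s * x i + s ^ 2)) ^ 2) 0 := by
      have hc : Filter.Tendsto (fun s : ℝ => x + s • e) (nhds 0) (nhds x) := by
        simpa using (hl 0).continuousAt.tendsto
      have := hc.eventually hmin
      filter_upwards [this] with s hs
      simpa [he, EuclideanSpace.norm_add_smul_single_sq] using hs
    have := hmin'.second_deriv_nonneg (fun s => ((h1 s).const_mul M).sub (h3 s))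
      ((h2.const_mul M).sub h4)
    linarith
  have hsum := Finset.sum_le_sum fun i (_ : i ∈ Finset.univ) => key i
  rw [← Finset.mul_sum, Finset.sum_sub_distrib, ← Finset.mul_sum,
    ← EuclideanSpace.real_norm_sq_eq] at hsum
  simp only [Finset.sum_const, Finset.card_univ, Fintype.card_fin, nsmul_eq_mul] at hsum
  unfold lap
  linarith

/-- Liouville-type theorem (paper's Example 1.3 + Corollaries 1.5, 1.2, Euclidean case):
for `a > 0`, there is no smooth positive solution of
`Δu + a u (π/2 − arctan(ln u)) = 0` on all of `ℝⁿ`. -/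
theorem stmt_17 (n : ℕ) (hn : 1 ≤ n) (a : ℝ) (ha : 0 < a) :
    ¬ ∃ u : EuclideanSpace ℝ (Fin n) → ℝ,
      ContDiff ℝ (⊤ : ℕ∞) u ∧ (∀ x, 0 < u x) ∧
      (∀ x, lap u x
        + a * u x * (Real.pi / 2 - Real.arctan (Real.log (u x))) = 0) := by
  rintro ⟨u, hu, hpos, heq⟩
  obtain ⟨h, hh⟩ : ∃ h, h = a * (Real.pi / 2 - Real.arctan (Real.log (u 0))) := ⟨_, rfl⟩
  have hh0 : 0 < h := hh ▸ mul_pos ha (sub_pos.2 (Real.arctan_lt_pi_div_two _))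
  obtain ⟨ρ, hρ⟩ : ∃ ρ : ℝ, ρ = (n + 2) ^ 2 / h := ⟨_, rfl⟩
  have hρ0 : 0 < ρ := hρ ▸ by positivity
  have hmem : ∀ y : EuclideanSpace ℝ (Fin n), y ∈ closedBall 0 (√ρ) ↔ ‖y‖ ^ 2 ≤ ρ := fun y => by
    rw [mem_closedBall_zero_iff, Real.le_sqrt (norm_nonneg _) hρ0.le]
  obtain ⟨x, hx, hmax⟩ := (isCompact_closedBall (0 : EuclideanSpace ℝ (Fin n)) (√ρ)).exists_isMaxOn
    ⟨0, by simp⟩ (f := fun y => (ρ - ‖y‖ ^ 2) ^ 2 / u y)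
    (Continuous.continuousOn (by
      have := hu.continuous
      exact Continuous.div (by fun_prop) this fun y => (hpos y).ne'))
  rw [hmem] at hx
  obtain ⟨M, hM⟩ : ∃ M, M = (ρ - ‖x‖ ^ 2) ^ 2 / u x := ⟨_, rfl⟩
  have hle : ∀ y, ‖y‖ ^ 2 ≤ ρ → (ρ - ‖y‖ ^ 2) ^ 2 ≤ M * u y := fun y hy => by
    have h1 : (ρ - ‖y‖ ^ 2) ^ 2 / u y ≤ M := hM ▸ hmax ((hmem y).2 hy)
    exact (div_le_iff₀ (hpos y)).1 h1
  have hMx : M * u x = (ρ - ‖x‖ ^ 2) ^ 2 := by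
    rw [hM, div_mul_cancel₀ _ (hpos x).ne']
  have h0 : ρ ^ 2 ≤ M * u 0 := by simpa using hle 0 (by simpa using hρ0.le)
  have hM0 : 0 < M := pos_of_mul_pos_left (lt_of_lt_of_le (by positivity) h0) (hpos 0).le
  have hlt : ‖x‖ ^ 2 < ρ := by
    refine lt_of_le_of_ne hx fun hE => ?_
    have := mul_pos hM0 (hpos x)
    rw [hMx, hE] at this
    simp at this
  have hux : u x ≤ u 0 := by
    refine le_of_mul_le_mul_left ?_ hM0
    rw [hMx]
    refine le_trans ?_ h0
    have := sq_nonneg ‖x‖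
    gcongr
    linarith
  have hmono : h ≤ a * (Real.pi / 2 - Real.arctan (Real.log (u x))) := by
    rw [hh]
    have := Real.arctan_mono (Real.log_le_log (hpos x) hux)
    exact mul_le_mul_of_nonneg_left (by linarith) ha.le
  have hmin : IsLocalMin (fun y => M * u y - (ρ - ‖y‖ ^ 2) ^ 2) x := by
    have hopen : ∀ᶠ y in nhds x, ‖y‖ ^ 2 < ρ :=
      (continuous_norm.pow 2).continuousAt.eventually_lt continuousAt_const hlt
    filter_upwards [hopen] with y hy
    have := hle y hy.le
    linarith
  have hlap := lap_ge_of_isLocalMin (contDiff_infty.1 hu 2) hmin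
  have hex : M * lap u x =
      -((ρ - ‖x‖ ^ 2) ^ 2 * (a * (Real.pi / 2 - Real.arctan (Real.log (u x))))) := by
    rw [← hMx]
    linear_combination M * heq x
  have hbd := mul_le_mul_of_nonneg_left hmono (sq_nonneg (ρ - ‖x‖ ^ 2))
  obtain ⟨t, ht⟩ : ∃ t, t = ρ - ‖x‖ ^ 2 := ⟨_, rfl⟩
  have hxt : ‖x‖ ^ 2 = ρ - t := by linarith
  rw [← ht] at hlap hex hbd
  rw [hxt] at hlap
  have hfin : t ^ 2 * h + 8 * ρ ≤ 4 * (n + 2) * t := by linarith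
  have hρh : ρ * h = (n + 2) ^ 2 := by rw [hρ]; field_simp
  have hprod := mul_le_mul_of_nonneg_right hfin hh0.le
  nlinarith [sq_nonneg (t * h - 2 * (n + 2)), mul_pos hρ0 hh0]
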